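/- arXiv:2208.09326 — 2 statements merged into one kernel-verified Lean document; each statement's English description precedes it below -/
import Mathlib

section
/- Theorem (IC implies MFF): If the pair (g, p) satisfies IC, then it satisfies MFF, i.e.: (a) for every r' : Finset α, the function fun v => g v r' is monotone non-decreasing; (b) for all r' : Finset α and v : ℝ, p v r' = p 0 r' + v * g v r' - ∫ y in (0:ℝ)..v, g y r'; and (c) for all r r' : Finset α with r' ⊆ r and all v : ℝ, p 0 r' - p 0 r ≥ ∫ y in (0:ℝ)..v, (g y r' - g y r). -/
/-- A function having a selection of subgradients is convex. -/
theorem convexOn_univ_of_subgradient {U g : ℝ → ℝ}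
    (h : ∀ x y, U x + (y - x) * g x ≤ U y) : ConvexOn ℝ Set.univ U := by
  refine ⟨convex_univ, fun x _ y _ a b ha hb hab => ?_⟩
  simp only [smul_eq_mul]
  set z := a * x + b * y with hz
  calc U z = a * (U z + (x - z) * g z) + b * (U z + (y - z) * g z) := by
        linear_combination (z * g z - U z) * hab + g z * hz
    _ ≤ a * U x + b * U y :=
        add_le_add (mul_le_mul_of_nonneg_left (h z x) ha) (mul_le_mul_of_nonneg_left (h z y) hb)

/-- A selection of subgradients is monotone. -/
theorem monotone_of_subgradient {U g : ℝ → ℝ}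
    (h : ∀ x y, U x + (y - x) * g x ≤ U y) : Monotone g := by
  intro x y hxy
  rcases hxy.eq_or_lt with rfl | hlt
  · exact le_rfl
  · nlinarith [h x y, h y x]

/-- A function is differentiable wherever a selection of its subgradients is continuous. -/
theorem hasDerivAt_of_subgradient {U g : ℝ → ℝ}
    (h : ∀ x y, U x + (y - x) * g x ≤ U y) {x : ℝ} (hx : ContinuousAt g x) :
    HasDerivAt U (g x) x := by
  rw [hasDerivAt_iff_isLittleO, Asymptotics.isLittleO_iff]
  intro c hc
  filter_upwards [Metric.continuousAt_iff'.mp hx c hc] with y hy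
  rw [Real.dist_eq] at hy
  simp only [smul_eq_mul, Real.norm_eq_abs]
  rw [abs_of_nonneg (by linarith [h x y])]
  calc U y - U x - (y - x) * g x ≤ (g y - g x) * (y - x) := by linarith [h y x]
    _ ≤ |g y - g x| * |y - x| := by rw [← abs_mul]; exact le_abs_self _
    _ ≤ c * |y - x| := by gcongr

/-- The integral of a selection of subgradients recovers the function. -/
theorem integral_eq_sub_of_subgradient {U g : ℝ → ℝ}
    (h : ∀ x y, U x + (y - x) * g x ≤ U y) (a b : ℝ) :
    ∫ x in a..b, g x = U b - U a := by
  have hg := monotone_of_subgradient h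
  refine MeasureTheory.integral_eq_of_hasDerivAt_off_countable U g hg.countable_not_continuousAt
    (((convexOn_univ_of_subgradient h).continuousOn isOpen_univ).mono (Set.subset_univ _))
    (fun x hx => hasDerivAt_of_subgradient h ?_) hg.intervalIntegrable
  simpa using hx.2


/-- Incentive compatibility (IC) of a diffusion auction, for a single agent
with the other agents' reports held fixed. -/
def IC {α : Type*} (g p : ℝ → Finset α → ℝ) : Prop :=
  ∀ r r' : Finset α, r' ⊆ r → ∀ v v' : ℝ,
    v * g v r - p v r ≥ v * g v' r' - p v' r'

/-- Diffusion dominant strategy incentive compatibility (DDSIC). -/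
def DDSIC {α : Type*} (g p : ℝ → Finset α → ℝ) : Prop :=
  (∀ r' : Finset α, ∀ v v' : ℝ,
    v * g v r' - p v r' ≥ v * g v' r' - p v' r') ∧
  (∀ r r' : Finset α, r' ⊆ r → ∀ v : ℝ,
    v * g v r - p v r ≥ v * g v r' - p v r')

/-- Monotonicity and forwarding-friendliness (MFF). -/
def MFF {α : Type*} (g p : ℝ → Finset α → ℝ) : Prop :=
  (∀ r' : Finset α, Monotone (fun v => g v r')) ∧
  (∀ r' : Finset α, ∀ v : ℝ,
    p v r' = p 0 r' + v * g v r' - ∫ y in (0:ℝ)..v, g y r') ∧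
  (∀ r r' : Finset α, r' ⊆ r → ∀ v : ℝ,
    p 0 r' - p 0 r ≥ ∫ y in (0:ℝ)..v, (g y r' - g y r))

/-- IC implies MFF. -/
theorem ic_implies_mff {α : Type*} (g p : ℝ → Finset α → ℝ)
    (h : IC g p) : MFF g p := by
  have hsub (r : Finset α) (x y : ℝ) :
      (x * g x r - p x r) + (y - x) * g x r ≤ y * g y r - p y r := by
    linarith [h r r subset_rfl y x]
  have hint (r : Finset α) (v : ℝ) :
      ∫ y in (0:ℝ)..v, g y r = (v * g v r - p v r) - (0 * g 0 r - p 0 r) :=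
    integral_eq_sub_of_subgradient (U := fun x => x * g x r - p x r) (hsub r) 0 v
  have hmono (r : Finset α) : Monotone (fun v => g v r) :=
    monotone_of_subgradient (U := fun x => x * g x r - p x r) (hsub r)
  refine ⟨hmono, fun r v => ?_, fun r r' hr v => ?_⟩
  · rw [hint]
    ring
  · rw [intervalIntegral.integral_sub (hmono r').intervalIntegrable (hmono r).intervalIntegrable,
      hint, hint]
    linarith [h r r' hr v v]
end

section
/- Theorem (MFF implies DDSIC): If the pair (g, p) satisfies MFF, then it satisfies DDSIC. -/
/-- The integral of a monotone function is bounded below by its value at the starting point times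
the signed length of the interval. -/
theorem Monotone.sub_mul_le_intervalIntegral {f : ℝ → ℝ} (hf : Monotone f) (a b : ℝ) :
    (b - a) * f a ≤ ∫ y in a..b, f y := by
  rcases le_total a b with hab | hba
  · simpa using intervalIntegral.integral_mono_on (μ := MeasureTheory.volume) hab
      (intervalIntegrable_const (c := f a)) hf.intervalIntegrable fun y hy => hf hy.1
  · have h := intervalIntegral.integral_mono_on (μ := MeasureTheory.volume) hba
      hf.intervalIntegrable (intervalIntegrable_const (c := f a)) fun y hy => hf hy.2
    rw [intervalIntegral.integral_const, smul_eq_mul] at h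
    rw [intervalIntegral.integral_symm]
    linarith

/-- MFF implies DDSIC. -/
theorem mff_implies_ddsic {α : Type*} (g p : ℝ → Finset α → ℝ)
    (h : MFF g p) : DDSIC g p := by
  obtain ⟨hmono, hpay, hfwd⟩ := h
  have hint (s : Finset α) (a b : ℝ) :
      IntervalIntegrable (fun y => g y s) MeasureTheory.volume a b :=
    (hmono s).intervalIntegrable
  refine ⟨fun s v v' => ?_, fun r r' hr v => ?_⟩
  · have hle := (hmono s).sub_mul_le_intervalIntegral v' v
    have hadd := intervalIntegral.integral_add_adjacent_intervals (hint s 0 v') (hint s v' v)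
    rw [hpay s v, hpay s v']
    linarith
  · have hle := hfwd r r' hr v
    rw [intervalIntegral.integral_sub (hint r' 0 v) (hint r 0 v)] at hle
    rw [hpay r v, hpay r' v]
    linarith
end
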